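/- arXiv:2507.05606 — 4 statements merged into one kernel-verified Lean document; each statement's English description precedes it below -/
import Mathlib

section
/- Fix n ≥ 1, revenues r_i > 0 and MNL preference weights v_i > 0 for i ∈ {1,…,n}, and a balancing parameter α with 0 < α < 1. Then the optimal value R* of the randomized balanced-market-share problem BMS satisfies (1−α)·R* ≤ 2 · R*_det, where R*_det is the optimal value of the deterministic balanced-market-share problem. -/
open Classical Finset

noncomputable section

/-- A vector `(x0, x)` is BMS-feasible: probabilities sum to one, each purchase
probability is between `0` and `v i * x0`, and each coordinate is either zero
or at least `α` times the maximum coordinate. -/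
def BMSFeasible (n : ℕ) (v : Fin n → ℝ) (α : ℝ) (x0 : ℝ) (x : Fin n → ℝ) : Prop :=
  x0 + ∑ i, x i = 1 ∧
  (∀ i, 0 ≤ x i ∧ x i ≤ v i * x0) ∧
  (∀ i, x i = 0 ∨ ∀ j, α * x j ≤ x i)

/-- Optimal value of the randomized balanced-market-share problem BMS. -/
def Rstar (n : ℕ) (r v : Fin n → ℝ) (α : ℝ) : ℝ :=
  sSup {R | ∃ x0 x, BMSFeasible n v α x0 x ∧ ∑ i, r i * x i = R}

/-- An assortment `S` is deterministically feasible for the market share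
balancing constraint: preference weights of offered products differ by at most
a factor of `α`. -/
def DetFeasible (n : ℕ) (v : Fin n → ℝ) (α : ℝ) (S : Finset (Fin n)) : Prop :=
  ∀ i ∈ S, ∀ j ∈ S, α * v j ≤ v i

/-- Expected revenue of assortment `S` under the MNL model. -/
def assortRev (n : ℕ) (r v : Fin n → ℝ) (S : Finset (Fin n)) : ℝ :=
  (∑ i ∈ S, r i * v i) / (1 + ∑ i ∈ S, v i)

/-- Optimal value of the deterministic balanced-market-share problem. -/
def RstarDet (n : ℕ) (r v : Fin n → ℝ) (α : ℝ) : ℝ :=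
  sSup {R | ∃ S : Finset (Fin n), DetFeasible n v α S ∧ assortRev n r v S = R}

theorem assortRev_le_RstarDet {n : ℕ} (r v : Fin n → ℝ) {α : ℝ} {S : Finset (Fin n)}
    (hS : DetFeasible n v α S) : assortRev n r v S ≤ RstarDet n r v α := by
  apply le_csSup
  · refine ((Set.finite_range (assortRev n r v)).subset ?_).bddAbove
    rintro _ ⟨T, -, rfl⟩
    exact ⟨T, rfl⟩
  · exact ⟨S, hS, rfl⟩

theorem RstarDet_nonneg {n : ℕ} (r v : Fin n → ℝ) (α : ℝ) : 0 ≤ RstarDet n r v α := by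
  have h : DetFeasible n v α ∅ := by simp [DetFeasible]
  simpa [assortRev] using assortRev_le_RstarDet r v h

/-- The total surplus of a balanced assortment above the deterministic optimum is at most
that optimum. -/
theorem sum_posPart_surplus_le {n : ℕ} {r v : Fin n → ℝ} (hv : ∀ i, 0 < v i) {α : ℝ}
    {S : Finset (Fin n)} (hS : DetFeasible n v α S) :
    ∑ i ∈ S, max (r i - RstarDet n r v α) 0 * v i ≤ RstarDet n r v α := by
  set D := RstarDet n r v α with hD
  set T := S.filter (fun i => D ≤ r i) with hT
  have hTfeas : DetFeasible n v α T := fun i hi j hj =>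
    hS i (Finset.mem_filter.1 hi).1 j (Finset.mem_filter.1 hj).1
  have hrev := assortRev_le_RstarDet r v hTfeas
  have hpos : 0 < 1 + ∑ i ∈ T, v i := by
    have := Finset.sum_nonneg (s := T) (fun i _ => (hv i).le)
    linarith
  rw [assortRev, div_le_iff₀ hpos, ← hD] at hrev
  have hsum : ∑ i ∈ S, max (r i - D) 0 * v i = ∑ i ∈ T, (r i - D) * v i := by
    rw [hT, Finset.sum_filter]
    refine Finset.sum_congr rfl fun i _ => ?_
    split_ifs with h
    · rw [max_eq_left (by linarith)]
    · rw [max_eq_right (by linarith), zero_mul]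
  rw [hsum]
  simp only [sub_mul, Finset.sum_sub_distrib, ← Finset.mul_sum]
  linarith

theorem one_sub_mul_sum_pow_pred_le {α : ℝ} (hα0 : 0 < α) (N : ℕ) :
    (1 - α) * ∑ k ∈ Finset.range N, α ^ (k - 1) ≤ 2 := by
  cases N with
  | zero => simp
  | succ N =>
    rw [Finset.sum_range_succ']
    simp only [Nat.add_sub_cancel, Nat.zero_sub, pow_zero]
    have h := mul_neg_geom_sum α N
    have := pow_pos hα0 N
    rw [mul_add, h]
    linarith

/-- The offered products can be sorted into balanced classes, class `k` being sold at most at a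
fraction `α ^ (k - 1)` of its unrestricted level. -/
theorem exists_balanced_classes {n : ℕ} {v : Fin n → ℝ} {α x0 : ℝ} {x : Fin n → ℝ}
    (hα0 : 0 < α) (hα1 : α < 1) (hx0 : 0 < x0) (hx : BMSFeasible n v α x0 x) :
    ∃ κ : Fin n → ℕ, ∀ k,
      DetFeasible n v α (Finset.univ.filter fun i => x i ≠ 0 ∧ κ i = k) ∧
      ∀ i, κ i = k → x i ≠ 0 → x i ≤ α ^ (k - 1) * (v i * x0) := by
  obtain ⟨-, hbd, hbal⟩ := hx
  have key : ∃ M : ℝ, (∀ i, x i ≤ M) ∧ ∀ i, x i ≠ 0 → 0 < M ∧ α * M ≤ x i := by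
    cases isEmpty_or_nonempty (Fin n) with
    | inl h => exact ⟨0, fun i => isEmptyElim i, fun i => isEmptyElim i⟩
    | inr h =>
      obtain ⟨j, hj⟩ := Finite.exists_max x
      refine ⟨x j, hj, fun i hi => ⟨?_, (hbal i).resolve_left hi j⟩⟩
      exact ((hbd i).1.lt_of_ne' hi).trans_le (hj i)
  obtain ⟨M, hM, hMα⟩ := key
  have hclass : ∀ i, ∃ k : ℕ, x i ≠ 0 →
      α * M ≤ α ^ k * (v i * x0) ∧ α ^ k * (v i * x0) ≤ M := by
    intro i
    by_cases hi : x i = 0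
    · exact ⟨0, fun h => absurd hi h⟩
    obtain ⟨hM0, hMi⟩ := hMα i hi
    have hαM : 0 < α * M := mul_pos hα0 hM0
    obtain ⟨k, hk1, hk2⟩ := exists_nat_pow_near (x := v i * x0 / (α * M)) (y := α⁻¹)
      ((one_le_div hαM).2 (hMi.trans (hbd i).2)) ((one_lt_inv₀ hα0).2 hα1)
    refine ⟨k, fun _ => ?_⟩
    rw [le_div_iff₀ hαM, inv_pow, inv_mul_le_iff₀ (pow_pos hα0 k)] at hk1
    rw [div_lt_iff₀ hαM, inv_pow, lt_inv_mul_iff₀ (pow_pos hα0 _), pow_succ'] at hk2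
    refine ⟨hk1, ?_⟩
    rw [mul_assoc] at hk2
    exact (lt_of_mul_lt_mul_left hk2 hα0.le).le
  choose κ hκ using hclass
  refine ⟨κ, fun k => ⟨fun i hi j hj => ?_, ?_⟩⟩
  · obtain ⟨hi0, hik⟩ := (Finset.mem_filter.1 hi).2
    obtain ⟨hj0, hjk⟩ := (Finset.mem_filter.1 hj).2
    have h1 := (hκ i hi0).1
    have h2 := (hκ j hj0).2
    rw [hik] at h1
    rw [hjk] at h2
    have h3 : α ^ k * x0 * (α * v j) ≤ α ^ k * x0 * v i := by
      have := mul_le_mul_of_nonneg_left h2 hα0.le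
      linarith
    exact le_of_mul_le_mul_left h3 (by positivity)
  · rintro i rfl hi
    obtain ⟨h1, -⟩ := hκ i hi
    cases hk : κ i with
    | zero => simpa using (hbd i).2
    | succ k =>
      rw [hk, pow_succ', mul_assoc] at h1
      exact (hM i).trans (le_of_mul_le_mul_left h1 hα0)

theorem one_sub_mul_revenue_le {n : ℕ} {r v : Fin n → ℝ} (hv : ∀ i, 0 < v i)
    {α x0 : ℝ} {x : Fin n → ℝ} (hα0 : 0 < α) (hα1 : α < 1) (hx0 : 0 < x0)
    (hx : BMSFeasible n v α x0 x) :
    (1 - α) * ∑ i, r i * x i ≤ 2 * RstarDet n r v α := by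
  obtain ⟨κ, hκ⟩ := exists_balanced_classes hα0 hα1 hx0 hx
  obtain ⟨hsum, hbd, -⟩ := hx
  have hD0 := RstarDet_nonneg r v α
  have hsurplus (S : Finset (Fin n)) (hS : DetFeasible n v α S) :=
    sum_posPart_surplus_le (r := r) hv hS
  set D := RstarDet n r v α
  obtain ⟨N, hN⟩ : ∃ N, ∀ i, κ i < N :=
    ⟨Finset.univ.sup κ + 1, fun i => Nat.lt_succ_of_le (Finset.le_sup (Finset.mem_univ i))⟩
  have hclass (k : ℕ) : ∑ i with κ i = k, max (r i - D) 0 * x i ≤ α ^ (k - 1) * x0 * D := by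
    calc ∑ i with κ i = k, max (r i - D) 0 * x i
        = ∑ i with x i ≠ 0 ∧ κ i = k, max (r i - D) 0 * x i := by
          simp only [Finset.sum_filter]
          refine Finset.sum_congr rfl fun i _ => ?_
          by_cases h : x i = 0 <;> simp [h]
      _ ≤ ∑ i with x i ≠ 0 ∧ κ i = k, α ^ (k - 1) * x0 * (max (r i - D) 0 * v i) := by
          refine Finset.sum_le_sum fun i hi => ?_
          obtain ⟨hi0, hik⟩ := (Finset.mem_filter.1 hi).2
          have := mul_le_mul_of_nonneg_left ((hκ k).2 i hik hi0) (le_max_right (r i - D) 0)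
          linarith
      _ ≤ α ^ (k - 1) * x0 * D := by
          rw [← Finset.mul_sum]
          exact mul_le_mul_of_nonneg_left (hsurplus _ (hκ k).1) (by positivity)
  have htotal : ∑ i, max (r i - D) 0 * x i ≤
      (∑ k ∈ Finset.range N, α ^ (k - 1)) * (x0 * D) := by
    rw [← Finset.sum_fiberwise_of_maps_to (t := Finset.range N) (g := κ)
      (fun i _ => Finset.mem_range.2 (hN i)), Finset.sum_mul]
    refine Finset.sum_le_sum fun k _ => ?_
    rw [← mul_assoc]
    exact hclass k
  have hrev : ∑ i, r i * x i ≤ D * (1 - x0) + ∑ i, max (r i - D) 0 * x i := by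
    rw [show 1 - x0 = ∑ i, x i by linarith, Finset.mul_sum, ← Finset.sum_add_distrib]
    refine Finset.sum_le_sum fun i _ => ?_
    have := mul_le_mul_of_nonneg_right (le_max_left (r i - D) 0) (hbd i).1
    linarith
  have hx1 : x0 ≤ 1 := by
    have := Finset.sum_nonneg (s := Finset.univ) (fun i _ => (hbd i).1)
    linarith
  have h1 := mul_le_mul_of_nonneg_right (one_sub_mul_sum_pow_pred_le hα0 N)
    (mul_nonneg hx0.le hD0)
  have h2 := mul_le_mul_of_nonneg_left (hrev.trans (add_le_add_right htotal _))
    (sub_nonneg.2 hα1.le)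
  have h3 : (1 - α) * (D * (1 - x0)) ≤ 2 * (D * (1 - x0)) :=
    mul_le_mul_of_nonneg_right (by linarith) (mul_nonneg hD0 (by linarith))
  linarith

/-- `(1 - α) · R* ≤ 2 · R*_det` when `0 < α < 1`. -/
theorem stmt_1 (n : ℕ) (hn : 1 ≤ n) (r v : Fin n → ℝ)
    (hr : ∀ i, 0 < r i) (hv : ∀ i, 0 < v i)
    (α : ℝ) (hα0 : 0 < α) (hα1 : α < 1) :
    (1 - α) * Rstar n r v α ≤ 2 * RstarDet n r v α := by
  have hα : 0 < 1 - α := by linarith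
  rw [← le_div_iff₀' hα]
  refine Real.sSup_le ?_ (div_nonneg (mul_nonneg zero_le_two (RstarDet_nonneg r v α)) hα.le)
  rintro _ ⟨x0, x, hx, rfl⟩
  rw [le_div_iff₀' hα]
  refine one_sub_mul_revenue_le hv hα0 hα1 ?_ hx
  by_contra! hx0
  have hx_nonpos (i : Fin n) : x i ≤ 0 :=
    (hx.2.1 i).2.trans (mul_nonpos_of_nonneg_of_nonpos (hv i).le hx0)
  have := Finset.sum_nonpos (s := Finset.univ) (fun i _ => hx_nonpos i)
  linarith [hx.1]
end
end

section
/- Fix n ≥ 1, revenues r_i > 0 and MNL preference weights v_i > 0 for i ∈ {1,…,n}, and a balancing parameter α ∈ (0,1]. Then (a) the supremum of ∑_{i=1}^n (r_i − R*)·w_i over all Problem-(3)-feasible vectors w ∈ ℝ^n equals R*; and (b) if w* is Problem-(3)-feasible and attains this supremum, then the vector x* defined by x*_i = w*_i/(1 + ∑_{j=1}^n w*_j) for i ∈ {1,…,n} and x*_0 = 1/(1 + ∑_{j=1}^n w*_j) is BMS-feasible and satisfies ∑_{i=1}^n r_i x*_i = R*. -/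
open Classical Finset

noncomputable section

/-- A vector `w` is Problem-(3)-feasible: `0 ≤ w i ≤ v i` and each coordinate
is either zero or at least `α` times the maximum coordinate. -/
def P3Feasible (n : ℕ) (v : Fin n → ℝ) (α : ℝ) (w : Fin n → ℝ) : Prop :=
  (∀ i, 0 ≤ w i ∧ w i ≤ v i) ∧
  (∀ i, w i = 0 ∨ ∀ j, α * w j ≤ w i)

theorem P3Feasible.one_add_sum_pos {n : ℕ} {v : Fin n → ℝ} {α : ℝ} {w : Fin n → ℝ}
    (h : P3Feasible n v α w) : 0 < 1 + ∑ j, w j := by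
  have := Finset.sum_nonneg fun i (_ : i ∈ Finset.univ) => (h.1 i).1
  linarith

theorem P3Feasible.bmsFeasible {n : ℕ} {v : Fin n → ℝ} {α : ℝ} {w : Fin n → ℝ}
    (h : P3Feasible n v α w) :
    BMSFeasible n v α (1 / (1 + ∑ j, w j)) (fun i => w i / (1 + ∑ j, w j)) := by
  have hS := h.one_add_sum_pos
  refine ⟨?_, fun i => ⟨div_nonneg (h.1 i).1 hS.le, ?_⟩, fun i => ?_⟩
  · rw [← Finset.sum_div, ← add_div, div_self hS.ne']
  · rw [mul_one_div]
    exact div_le_div_of_nonneg_right (h.1 i).2 hS.le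
  · rcases h.2 i with h0 | h1
    · exact Or.inl (by simp [h0])
    · refine Or.inr fun j => ?_
      rw [← mul_div_assoc]
      exact div_le_div_of_nonneg_right (h1 j) hS.le

theorem BMSFeasible.pos {n : ℕ} {v : Fin n → ℝ} (hv : ∀ i, 0 < v i) {α x0 : ℝ}
    {x : Fin n → ℝ} (h : BMSFeasible n v α x0 x) : 0 < x0 := by
  by_contra! hx0
  have hx : ∀ i, x i = 0 := fun i =>
    le_antisymm ((h.2.1 i).2.trans (mul_nonpos_of_nonneg_of_nonpos (hv i).le hx0)) (h.2.1 i).1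
  have h1 := h.1
  simp only [hx, Finset.sum_const_zero, add_zero] at h1
  linarith

theorem BMSFeasible.p3Feasible {n : ℕ} {v : Fin n → ℝ} {α x0 : ℝ} {x : Fin n → ℝ}
    (h : BMSFeasible n v α x0 x) (hx0 : 0 < x0) : P3Feasible n v α (fun i => x i / x0) := by
  refine ⟨fun i => ⟨div_nonneg (h.2.1 i).1 hx0.le, (div_le_iff₀ hx0).2 (h.2.1 i).2⟩, fun i => ?_⟩
  rcases h.2.2 i with h0 | h1
  · exact Or.inl (by simp [h0])
  · refine Or.inr fun j => ?_
    rw [← mul_div_assoc]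
    exact div_le_div_of_nonneg_right (h1 j) hx0.le

theorem BMSFeasible.le_weight {n : ℕ} {v : Fin n → ℝ} (hv : ∀ i, 0 < v i) {α x0 : ℝ}
    {x : Fin n → ℝ} (h : BMSFeasible n v α x0 x) (i : Fin n) : x i ≤ v i := by
  have hs := Finset.sum_nonneg fun i (_ : i ∈ Finset.univ) => (h.2.1 i).1
  have hx0 : x0 ≤ 1 := by linarith [h.1]
  exact (h.2.1 i).2.trans (mul_le_of_le_one_right (hv i).le hx0)

theorem isLUB_Rstar {n : ℕ} {r v : Fin n → ℝ} (hr : ∀ i, 0 < r i) (hv : ∀ i, 0 < v i) (α : ℝ) :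
    IsLUB {R | ∃ x0 x, BMSFeasible n v α x0 x ∧ ∑ i, r i * x i = R} (Rstar n r v α) := by
  refine isLUB_csSup ⟨0, 1, 0, ⟨by simp, fun i => by simpa using (hv i).le, by simp⟩, by simp⟩
    ⟨∑ i, r i * v i, ?_⟩
  rintro _ ⟨x0, x, h, rfl⟩
  exact Finset.sum_le_sum fun i _ => mul_le_mul_of_nonneg_left (h.le_weight hv i) (hr i).le

theorem isLUB_p3_value {n : ℕ} {r v : Fin n → ℝ} (hr : ∀ i, 0 < r i)
    (hv : ∀ i, 0 < v i) (α : ℝ) :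
    IsLUB {val : ℝ | ∃ w : Fin n → ℝ, P3Feasible n v α w ∧
      ∑ i, (r i - Rstar n r v α) * w i = val} (Rstar n r v α) := by
  have hR := isLUB_Rstar hr hv α
  set R := Rstar n r v α
  constructor
  · rintro _ ⟨w, hw, rfl⟩
    have hle := hR.1 ⟨_, _, hw.bmsFeasible, rfl⟩
    simp only [← mul_div_assoc, ← Finset.sum_div] at hle
    rw [div_le_iff₀ hw.one_add_sum_pos] at hle
    simp only [sub_mul, Finset.sum_sub_distrib, ← Finset.mul_sum]
    linarith
  · intro b hb
    have hM : 0 < 1 + ∑ i, v i := by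
      have := Finset.sum_nonneg fun i (_ : i ∈ Finset.univ) => (hv i).le
      linarith
    by_contra! hbR
    obtain ⟨_, ⟨x0, x, hx, rfl⟩, hlt, hle⟩ := hR.exists_between
      (sub_lt_self R (div_pos (sub_pos.2 hbR) hM))
    have hx0 := hx.pos hv
    have hw := hx.p3Feasible hx0
    have hval := hb ⟨_, hw, rfl⟩
    have hS : 1 + ∑ i, x i / x0 = 1 / x0 := by
      rw [← Finset.sum_div, eq_div_iff hx0.ne', add_mul, div_mul_cancel₀ _ hx0.ne', one_mul, hx.1]
    have hSM : 1 / x0 ≤ 1 + ∑ i, v i := by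
      rw [← hS]
      exact add_le_add_right (Finset.sum_le_sum fun i _ => (hw.1 i).2) 1
    have hgap : (R - ∑ i, r i * x i) * (1 + ∑ i, v i) < R - b := by
      rw [← lt_div_iff₀ hM]
      linarith
    have hgap' := (mul_le_mul_of_nonneg_left hSM (sub_nonneg.2 hle)).trans_lt hgap
    simp only [sub_mul, Finset.sum_sub_distrib, ← Finset.mul_sum, ← mul_div_assoc,
      ← Finset.sum_div] at hval hS
    have heq : (∑ i, r i * x i - R * ∑ i, x i) / x0 = R - (R - ∑ i, r i * x i) * (1 / x0) := by
      linear_combination -R * hS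
    linarith

/-- (a) the optimal value of Problem (3) is `R*`; and (b) from any
optimal solution `w*` of Problem (3), the reconstruction
`x*_i = w*_i / (1 + ∑_j w*_j)`, `x*_0 = 1/(1 + ∑_j w*_j)` is an optimal
BMS-feasible solution. -/
theorem stmt_4 (n : ℕ) (hn : 1 ≤ n) (r v : Fin n → ℝ)
    (hr : ∀ i, 0 < r i) (hv : ∀ i, 0 < v i)
    (α : ℝ) (hα0 : 0 < α) (hα1 : α ≤ 1) :
    sSup {val : ℝ | ∃ w : Fin n → ℝ, P3Feasible n v α w ∧
        ∑ i, (r i - Rstar n r v α) * w i = val} = Rstar n r v α ∧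
    ∀ w : Fin n → ℝ, P3Feasible n v α w →
      ∑ i, (r i - Rstar n r v α) * w i =
        sSup {val : ℝ | ∃ w' : Fin n → ℝ, P3Feasible n v α w' ∧
          ∑ i, (r i - Rstar n r v α) * w' i = val} →
      BMSFeasible n v α (1 / (1 + ∑ j, w j)) (fun i => w i / (1 + ∑ j, w j)) ∧
      ∑ i, r i * (w i / (1 + ∑ j, w j)) = Rstar n r v α := by
  have hP := isLUB_p3_value hr hv α
  have hsup := hP.csSup_eq ⟨_, 0, ⟨fun i => by simpa using (hv i).le, by simp⟩, rfl⟩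
  refine ⟨hsup, fun w hw hopt => ⟨hw.bmsFeasible, ?_⟩⟩
  rw [hsup] at hopt
  simp only [sub_mul, Finset.sum_sub_distrib, ← Finset.mul_sum] at hopt
  simp only [← mul_div_assoc, ← Finset.sum_div]
  rw [div_eq_iff hw.one_add_sum_pos.ne']
  linarith
end
end

section
/- Fix n ≥ 1, revenues r_i > 0 and MNL preference weights v_i > 0 for i ∈ {1,…,n}, a balancing parameter α ∈ (0,1], and a nonempty collection 𝒳 of subsets of {1,…,n}. Then there exist v̄ ∈ {v_i : i ∈ {1,…,n}} ∪ {α·v_i : i ∈ {1,…,n}} and S* ∈ 𝒳 with v_i ≥ v̄ for all i ∈ S*, such that the vector w* defined by w*_i = min{v_i, v̄/α} if i ∈ S* and r_i ≥ R*_𝒳, w*_i = v̄ if i ∈ S* and r_i < R*_𝒳, and w*_i = 0 if i ∉ S*, is Problem-(6)-feasible and satisfies ∑_{i=1}^n (r_i − R*_𝒳)·w*_i = R*_𝒳 (i.e., w* attains the supremum of Problem (6), which equals R*_𝒳). -/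
open Classical Finset

noncomputable section

/-- The support of a purchase-probability vector, as a finite set of products. -/
def suppF (n : ℕ) (x : Fin n → ℝ) : Finset (Fin n) :=
  Finset.univ.filter (fun i => 0 < x i)

/-- A vector `(x0, x)` is BMS-C-feasible: it is BMS-feasible and the set of
products offered with positive probability belongs to `𝒳`. -/
def BMSCFeasible (n : ℕ) (v : Fin n → ℝ) (α : ℝ) (𝒳 : Set (Finset (Fin n)))
    (x0 : ℝ) (x : Fin n → ℝ) : Prop :=
  BMSFeasible n v α x0 x ∧ suppF n x ∈ 𝒳

/-- Optimal value `R*_𝒳` of the constrained problem BMS-C. -/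
def RstarX (n : ℕ) (r v : Fin n → ℝ) (α : ℝ) (𝒳 : Set (Finset (Fin n))) : ℝ :=
  sSup {R | ∃ x0 x, BMSCFeasible n v α 𝒳 x0 x ∧ ∑ i, r i * x i = R}

/-- A vector `w` is Problem-(6)-feasible: `0 ≤ w i ≤ v i`, each coordinate is
either zero or at least `α` times the maximum coordinate, and the support of
`w` belongs to `𝒳`. -/
def P6Feasible (n : ℕ) (v : Fin n → ℝ) (α : ℝ) (𝒳 : Set (Finset (Fin n)))
    (w : Fin n → ℝ) : Prop :=
  (∀ i, 0 ≤ w i ∧ w i ≤ v i) ∧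
  (∀ i, w i = 0 ∨ ∀ j, α * w j ≤ w i) ∧
  suppF n w ∈ 𝒳

/-- The structural candidate solution of Lemma 3 (Equation (7)):
`w*_i = min{v_i, v̄/α}` if `i ∈ S*` and `r_i ≥ R`, `w*_i = v̄` if `i ∈ S*` and
`r_i < R`, and `w*_i = 0` if `i ∉ S*`. -/
def wStarC (n : ℕ) (r v : Fin n → ℝ) (α R vbar : ℝ) (S : Finset (Fin n)) :
    Fin n → ℝ :=
  fun i => if i ∈ S then (if R ≤ r i then min (v i) (vbar / α) else vbar) else 0

/-- The modified preference weights `v'` used in Transformed-MNL: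
`v'_i = v̄` if `r_i < R` and `v'_i = min{v_i, v̄/α}` if `r_i ≥ R`. -/
def modW (n : ℕ) (r v : Fin n → ℝ) (α R vbar : ℝ) : Fin n → ℝ :=
  fun i => if R ≤ r i then min (v i) (vbar / α) else vbar

section

variable {n : ℕ} {r v : Fin n → ℝ} {α : ℝ} {𝒳 : Set (Finset (Fin n))}

theorem suppF_div {x : Fin n → ℝ} {c : ℝ} (hc : 0 < c) :
    suppF n (fun i => x i / c) = suppF n x := by
  ext i
  simp [suppF, div_pos_iff_of_pos_right hc]

theorem BMSFeasible.x0_pos {x0 : ℝ} {x : Fin n → ℝ} (hv : ∀ i, 0 < v i)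
    (h : BMSFeasible n v α x0 x) : 0 < x0 := by
  obtain ⟨hsum, hb, -⟩ := h
  by_contra! hx0
  have hx : ∑ i, x i ≤ 0 := Finset.sum_nonpos fun i _ =>
    (hb i).2.trans (mul_nonpos_of_nonneg_of_nonpos (hv i).le hx0)
  linarith

theorem BMSFeasible.one_le_mul_x0 {x0 : ℝ} {x : Fin n → ℝ}
    (h : BMSFeasible n v α x0 x) : 1 ≤ (1 + ∑ i, v i) * x0 := by
  obtain ⟨hsum, hb, -⟩ := h
  have : ∑ i, x i ≤ ∑ i, v i * x0 := Finset.sum_le_sum fun i _ => (hb i).2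
  rw [← Finset.sum_mul] at this
  linarith

theorem BMSCFeasible.p6Feasible_div {x0 : ℝ} {x : Fin n → ℝ} (hv : ∀ i, 0 < v i)
    (h : BMSCFeasible n v α 𝒳 x0 x) : P6Feasible n v α 𝒳 (fun i => x i / x0) := by
  have h0 := h.1.x0_pos hv
  obtain ⟨⟨-, hb, hbal⟩, hs⟩ := h
  refine ⟨fun i => ⟨div_nonneg (hb i).1 h0.le, (div_le_iff₀ h0).2 (hb i).2⟩, fun i => ?_, ?_⟩
  · rcases hbal i with hi | hi
    · exact Or.inl (by simp [hi])
    · refine Or.inr fun j => ?_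
      rw [← mul_div_assoc]
      exact div_le_div_of_nonneg_right (hi j) h0.le
  · rwa [suppF_div h0]

theorem P6Feasible.bmscFeasible_div {w : Fin n → ℝ} (h : P6Feasible n v α 𝒳 w) :
    BMSCFeasible n v α 𝒳 (1 / (1 + ∑ i, w i)) (fun i => w i / (1 + ∑ i, w i)) := by
  obtain ⟨hb, hbal, hs⟩ := h
  have hW : 0 ≤ ∑ i, w i := Finset.sum_nonneg fun i _ => (hb i).1
  have h0 : 0 < 1 + ∑ i, w i := by linarith
  refine ⟨⟨?_, fun i => ⟨div_nonneg (hb i).1 h0.le, ?_⟩, fun i => ?_⟩, ?_⟩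
  · rw [← Finset.sum_div, ← add_div, div_self h0.ne']
  · rw [mul_one_div]
    exact div_le_div_of_nonneg_right (hb i).2 h0.le
  · rcases hbal i with hi | hi
    · exact Or.inl (by simp [hi])
    · refine Or.inr fun j => ?_
      rw [← mul_div_assoc]
      exact div_le_div_of_nonneg_right (hi j) h0.le
  · rwa [suppF_div h0]

theorem bddAbove_revenue (hr : ∀ i, 0 < r i) (hv : ∀ i, 0 < v i) :
    BddAbove {R | ∃ x0 x, BMSCFeasible n v α 𝒳 x0 x ∧ ∑ i, r i * x i = R} := by
  refine ⟨∑ i, r i, ?_⟩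
  rintro _ ⟨x0, x, h, rfl⟩
  have h0 := h.1.x0_pos hv
  obtain ⟨⟨hsum, hb, -⟩, -⟩ := h
  refine Finset.sum_le_sum fun i _ => mul_le_of_le_one_right (hr i).le ?_
  have := Finset.single_le_sum (fun j _ => (hb j).1) (Finset.mem_univ i)
  linarith

theorem RstarX_nonneg (hr : ∀ i, 0 < r i) : 0 ≤ RstarX n r v α 𝒳 := by
  refine Real.sSup_nonneg ?_
  rintro _ ⟨x0, x, h, rfl⟩
  exact Finset.sum_nonneg fun i _ => mul_nonneg (hr i).le (h.1.2.1 i).1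

theorem sum_sub_mul (R : ℝ) (x : Fin n → ℝ) :
    ∑ i, (r i - R) * x i = ∑ i, r i * x i - R * ∑ i, x i := by
  simp only [sub_mul, Finset.sum_sub_distrib, Finset.mul_sum]

theorem P6Feasible.sum_le_RstarX {w : Fin n → ℝ} (hr : ∀ i, 0 < r i) (hv : ∀ i, 0 < v i)
    (h : P6Feasible n v α 𝒳 w) :
    ∑ i, (r i - RstarX n r v α 𝒳) * w i ≤ RstarX n r v α 𝒳 := by
  have hW : 0 ≤ ∑ i, w i := Finset.sum_nonneg fun i _ => (h.1 i).1
  have h0 : 0 < 1 + ∑ i, w i := by linarith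
  have hle : ∑ i, r i * (w i / (1 + ∑ i, w i)) ≤ RstarX n r v α 𝒳 :=
    le_csSup (bddAbove_revenue hr hv) ⟨_, _, h.bmscFeasible_div, rfl⟩
  simp only [← mul_div_assoc] at hle
  rw [← Finset.sum_div, div_le_iff₀ h0] at hle
  rw [sum_sub_mul]
  linarith

/-- Any upper bound on the objective of Problem (6) is an upper bound on `R*_𝒳`. -/
theorem RstarX_le_of_forall_p6Feasible {w₀ : Fin n → ℝ} {f : ℝ} (hv : ∀ i, 0 < v i)
    (hw₀ : P6Feasible n v α 𝒳 w₀)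
    (hf : ∀ w, P6Feasible n v α 𝒳 w → ∑ i, (r i - RstarX n r v α 𝒳) * w i ≤ f) :
    RstarX n r v α 𝒳 ≤ f := by
  set R := RstarX n r v α 𝒳 with hR
  by_contra! hlt
  have hV : 0 < 1 + ∑ i, v i := by
    have := Finset.sum_nonneg fun i (_ : i ∈ Finset.univ) => (hv i).le
    linarith
  have hle : R ≤ R - (R - f) / (1 + ∑ i, v i) := by
    refine csSup_le ⟨_, _, _, hw₀.bmscFeasible_div, rfl⟩ ?_
    rintro _ ⟨x0, x, h, rfl⟩
    have h0 := h.1.x0_pos hv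
    have h1 := hf _ (h.p6Feasible_div hv)
    simp only [← mul_div_assoc] at h1
    rw [← Finset.sum_div, div_le_iff₀ h0, sum_sub_mul] at h1
    have h2 : ∑ i, x i = 1 - x0 := by linarith [h.1.1]
    rw [h2] at h1
    have h3 : (R - f) / (1 + ∑ i, v i) ≤ (R - f) * x0 := by
      rw [div_le_iff₀ hV]
      nlinarith [h.1.one_le_mul_x0]
    linarith
  have : 0 < (R - f) / (1 + ∑ i, v i) := div_pos (by linarith) hV
  linarith

theorem p6Feasible_wStarC (hv : ∀ i, 0 < v i) (hα0 : 0 < α) (hα1 : α ≤ 1) (R : ℝ) {t : ℝ}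
    (ht : 0 < t) {S : Finset (Fin n)} (hS : S ∈ 𝒳) (hSv : ∀ i ∈ S, t ≤ v i) :
    P6Feasible n v α 𝒳 (wStarC n r v α R t S) := by
  have htα : t ≤ t / α := le_div_self ht.le hα0 hα1
  have hlow : ∀ i ∈ S, t ≤ wStarC n r v α R t S i := by
    intro i hi
    simp only [wStarC, if_pos hi]
    split_ifs
    · exact le_min (hSv i hi) htα
    · exact le_rfl
  have hout : ∀ i ∉ S, wStarC n r v α R t S i = 0 := fun i hi => by simp [wStarC, hi]
  refine ⟨fun i => ?_, fun i => ?_, ?_⟩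
  · by_cases hi : i ∈ S
    · refine ⟨ht.le.trans (hlow i hi), ?_⟩
      simp only [wStarC, if_pos hi]
      split_ifs
      · exact min_le_left _ _
      · exact hSv i hi
    · simp [hout i hi, (hv i).le]
  · by_cases hi : i ∈ S
    · refine Or.inr fun j => le_trans ?_ (hlow i hi)
      rw [← le_div_iff₀' hα0]
      simp only [wStarC]
      split_ifs
      · exact min_le_right _ _
      · exact htα
      · exact ht.le.trans htα
    · exact Or.inl (hout i hi)
  · convert hS
    ext i
    by_cases hi : i ∈ S
    · simp [suppF, hi, ht.trans_le (hlow i hi)]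
    · simp [suppF, hi, hout i hi]

/-- A feasible vector is dominated by the candidate on its support whose threshold is its least
positive coordinate. -/
theorem P6Feasible.exists_wStarC_ge {w : Fin n → ℝ} (hα0 : 0 < α) (R : ℝ)
    (h : P6Feasible n v α 𝒳 w) (hne : (suppF n w).Nonempty) :
    ∃ u, 0 < u ∧ (∀ i ∈ suppF n w, u ≤ v i) ∧
      ∑ i, (r i - R) * w i ≤ ∑ i, (r i - R) * wStarC n r v α R u (suppF n w) i := by
  obtain ⟨k, hk, hmin⟩ := Finset.exists_min_image (suppF n w) w hne
  have hkpos : 0 < w k := by simpa [suppF] using hk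
  refine ⟨w k, hkpos, fun i hi => (hmin i hi).trans (h.1 i).2, Finset.sum_le_sum fun i _ => ?_⟩
  by_cases hi : i ∈ suppF n w
  · simp only [wStarC, if_pos hi]
    split_ifs with hR
    · refine mul_le_mul_of_nonneg_left (le_min (h.1 i).2 ?_) (by linarith)
      rw [le_div_iff₀' hα0]
      exact (h.2.1 k).resolve_left hkpos.ne' i
    · exact mul_le_mul_of_nonpos_left (hmin i hi) (by linarith)
  · have hi0 : w i = 0 := by
      have : ¬ 0 < w i := by simpa [suppF] using hi
      exact le_antisymm (not_lt.1 this) (h.1 i).1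
    simp [wStarC, hi, hi0]

/-- Between consecutive breakpoints, the candidate depends affinely on the threshold. -/
theorem wStarC_affine (hα0 : 0 < α) (R : ℝ) (S : Finset (Fin n)) {a u b : ℝ} (hau : a ≤ u)
    (hub : u ≤ b) (i : Fin n) (hi : α * v i ≤ a ∨ b ≤ α * v i) :
    (b - a) * wStarC n r v α R u S i =
      (b - u) * wStarC n r v α R a S i + (u - a) * wStarC n r v α R b S i := by
  simp only [wStarC]
  split_ifs
  · rcases hi with hi | hi
    · have key : ∀ t, a ≤ t → min (v i) (t / α) = v i := fun t ht =>
        min_eq_left ((le_div_iff₀' hα0).2 (hi.trans ht))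
      rw [key a le_rfl, key u hau, key b (hau.trans hub)]
      ring
    · have key : ∀ t, t ≤ b → min (v i) (t / α) = t / α := fun t ht =>
        min_eq_right ((div_le_iff₀' hα0).2 (ht.trans hi))
      rw [key a (hau.trans hub), key u hub, key b le_rfl]
      ring
  · ring
  · ring

/-- An arbitrary threshold is no better than some breakpoint, or than the zero vector. -/
theorem exists_breakpoint_ge (hv : ∀ i, 0 < v i) (hα0 : 0 < α) (R : ℝ) {S : Finset (Fin n)}
    (hne : S.Nonempty) {u : ℝ} (hu : 0 < u) (hSu : ∀ i ∈ S, u ≤ v i) :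
    ∑ i, (r i - R) * wStarC n r v α R u S i ≤ 0 ∨
      ∃ t, (∃ i, t = v i ∨ t = α * v i) ∧ (∀ i ∈ S, t ≤ v i) ∧
        ∑ i, (r i - R) * wStarC n r v α R u S i ≤ ∑ i, (r i - R) * wStarC n r v α R t S i := by
  set g : ℝ → ℝ := fun t => ∑ i, (r i - R) * wStarC n r v α R t S i with hg
  set P : Finset ℝ := Finset.univ.image v ∪ Finset.univ.image (fun i => α * v i) with hP
  have memP : ∀ {t}, t ∈ P ↔ ∃ i, t = v i ∨ t = α * v i := by
    intro t
    simp only [hP, Finset.mem_union, Finset.mem_image, Finset.mem_univ, true_and, exists_or,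
      eq_comm]
  obtain ⟨k, hk, hmin⟩ := Finset.exists_min_image S v hne
  obtain ⟨b, hb, hbmin⟩ := Finset.exists_min_image (P.filter (u ≤ ·)) id
    ⟨v k, by simpa [hSu k hk] using memP.2 ⟨k, Or.inl rfl⟩⟩
  obtain ⟨a, ha, hamax⟩ := Finset.exists_max_image ((insert 0 P).filter (· < u)) id
    ⟨0, by simp [hu]⟩
  simp only [Finset.mem_filter, Finset.mem_insert, id, and_imp] at hb hbmin ha hamax
  have hbk : b ≤ v k := hbmin _ (memP.2 ⟨k, Or.inl rfl⟩) (hSu k hk)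
  have haff : (b - a) * g u = (b - u) * g a + (u - a) * g b := by
    simp only [hg, Finset.mul_sum, ← Finset.sum_add_distrib]
    refine Finset.sum_congr rfl fun i _ => ?_
    have hi : α * v i ≤ a ∨ b ≤ α * v i := by
      have hmem : α * v i ∈ P := memP.2 ⟨i, Or.inr rfl⟩
      rcases lt_or_ge (α * v i) u with hlt | hge
      · exact Or.inl (hamax _ (Or.inr hmem) hlt)
      · exact Or.inr (hbmin _ hmem hge)
    linear_combination (r i - R) * wStarC_affine (r := r) hα0 R S ha.2.le hb.2 i hi
  have hab : g u ≤ g a ∨ g u ≤ g b := by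
    by_contra! hcon
    nlinarith [mul_nonneg (sub_nonneg.2 hb.2) (sub_nonneg.2 hcon.1.le),
      mul_pos (sub_pos.2 ha.2) (sub_pos.2 hcon.2)]
  rcases hab with hle | hle
  · rcases ha.1 with rfl | haP
    · left
      have h0 : g 0 = 0 := Finset.sum_eq_zero fun i _ => by
        simp [wStarC, (hv i).le]
      exact hle.trans h0.le
    · exact Or.inr ⟨a, memP.1 haP, fun i hi => ha.2.le.trans (hSu i hi), hle⟩
  · exact Or.inr ⟨b, memP.1 hb.1, fun i hi => hbk.trans (hmin i hi), hle⟩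

end

/-- Lemma 3: there exist a threshold
`v̄ ∈ {v_i : i} ∪ {α·v_i : i}` and `S* ∈ 𝒳` with `v_i ≥ v̄` on `S*` such that
the structural candidate `w*` is an optimal solution to Problem (6). -/
theorem stmt_7 (n : ℕ) (hn : 1 ≤ n) (r v : Fin n → ℝ)
    (hr : ∀ i, 0 < r i) (hv : ∀ i, 0 < v i)
    (α : ℝ) (hα0 : 0 < α) (hα1 : α ≤ 1)
    (𝒳 : Set (Finset (Fin n))) (hX : 𝒳.Nonempty) :
    ∃ vbar : ℝ, (∃ i, vbar = v i ∨ vbar = α * v i) ∧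
      ∃ S ∈ 𝒳, (∀ i ∈ S, vbar ≤ v i) ∧
        P6Feasible n v α 𝒳 (wStarC n r v α (RstarX n r v α 𝒳) vbar S) ∧
        ∑ i, (r i - RstarX n r v α 𝒳) * wStarC n r v α (RstarX n r v α 𝒳) vbar S i =
          RstarX n r v α 𝒳 := by
  set R := RstarX n r v α 𝒳 with hR
  have hR0 : 0 ≤ R := RstarX_nonneg hr
  let C : Set (ℝ × Finset (Fin n)) :=
    {p | (∃ i, p.1 = v i ∨ p.1 = α * v i) ∧ p.2 ∈ 𝒳 ∧ ∀ i ∈ p.2, p.1 ≤ v i}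
  let g : ℝ × Finset (Fin n) → ℝ := fun p => ∑ i, (r i - R) * wStarC n r v α R p.1 p.2 i
  have hCpos : ∀ p ∈ C, 0 < p.1 := by
    rintro p ⟨⟨i, hi | hi⟩, -⟩
    · exact hi ▸ hv i
    · exact hi ▸ mul_pos hα0 (hv i)
  have hCfeas : ∀ p ∈ C, P6Feasible n v α 𝒳 (wStarC n r v α R p.1 p.2) := fun p hp =>
    p6Feasible_wStarC hv hα0 hα1 R (hCpos p hp) hp.2.1 hp.2.2
  have hCfin : C.Finite := by
    refine (((Set.finite_range v).union (Set.finite_range fun i => α * v i)).prod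
      (Set.toFinite (Set.univ : Set (Finset (Fin n))))).subset ?_
    rintro p ⟨⟨i, hi | hi⟩, -⟩
    · exact ⟨Or.inl ⟨i, hi.symm⟩, Set.mem_univ _⟩
    · exact ⟨Or.inr ⟨i, hi.symm⟩, Set.mem_univ _⟩
  have hCne : C.Nonempty := by
    obtain ⟨S, hS⟩ := hX
    obtain ⟨k, -, hk⟩ := Finset.exists_min_image Finset.univ v ⟨⟨0, hn⟩, Finset.mem_univ _⟩
    exact ⟨(v k, S), ⟨k, Or.inl rfl⟩, hS, fun i _ => hk i (Finset.mem_univ i)⟩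
  obtain ⟨p, hp, hmax⟩ := Set.exists_max_image C g hCfin hCne
  refine ⟨p.1, hp.1, p.2, hp.2.1, hp.2.2, hCfeas p hp,
    le_antisymm ((hCfeas p hp).sum_le_RstarX hr hv) ?_⟩
  rcases hR0.eq_or_lt with h0 | hRpos
  · rw [← h0]
    exact Finset.sum_nonneg fun i _ => mul_nonneg (by linarith [hr i])
      (h0 ▸ ((hCfeas p hp).1 i).1)
  have hle : R ≤ max 0 (g p) := by
    refine RstarX_le_of_forall_p6Feasible hv (hCfeas p hp) fun w hw => ?_
    rcases (suppF n w).eq_empty_or_nonempty with hempty | hne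
    · refine le_max_of_le_left (Finset.sum_nonpos fun i _ => ?_)
      have hi : ¬ 0 < w i := fun hpos => by
        have : i ∈ suppF n w := by simp [suppF, hpos]
        simp [hempty] at this
      simp [le_antisymm (not_lt.1 hi) (hw.1 i).1]
    · obtain ⟨u, hu, hSu, hwu⟩ := hw.exists_wStarC_ge (r := r) hα0 R hne
      rcases exists_breakpoint_ge (r := r) hv hα0 R hne hu hSu with hneg | ⟨t, ht, htS, hut⟩
      · exact le_max_of_le_left (hwu.trans hneg)
      · exact le_max_of_le_right
          ((hwu.trans hut).trans (hmax (t, suppF n w) ⟨ht, hw.2.2, htS⟩))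
  exact (le_max_iff.1 hle).resolve_left hRpos.not_ge
end
end

section
/- Fix n ≥ 1, revenues r_i > 0, MNL preference weights v_i > 0, a balancing parameter α ∈ (0,1], a horizon T ∈ ℤ⁺, and inventories c_i ∈ ℤ⁺. Then every UB-feasible vector x* that attains the optimal value of the Upper-Bound problem satisfies max_{i∈{1,…,n}} x*_i ≥ min{ (min_{i} c_i)/T , (min_{i} v_i)/(1 + n·max_{i} v_i) }. -/
open Classical Finset

noncomputable section

/-- A vector `(x0, x)` is UB-feasible: it is BMS-feasible and additionally
`x i ≤ c i / T` for every product. -/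
def UBFeasible (n : ℕ) (v : Fin n → ℝ) (α : ℝ) (T : ℕ) (c : Fin n → ℕ)
    (x0 : ℝ) (x : Fin n → ℝ) : Prop :=
  BMSFeasible n v α x0 x ∧ ∀ i, x i ≤ (c i : ℝ) / (T : ℝ)

/-- Optimal value of the Upper-Bound problem. -/
def UBopt (n : ℕ) (r v : Fin n → ℝ) (α : ℝ) (T : ℕ) (c : Fin n → ℕ) : ℝ :=
  sSup {R | ∃ x0 x, UBFeasible n v α T c x0 x ∧ (T : ℝ) * ∑ i, r i * x i = R}

/-- The objective values of the Upper-Bound problem are bounded above. -/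
lemma bddAbove_UB (n : ℕ) (r v : Fin n → ℝ) (hr : ∀ i, 0 < r i) (α : ℝ) (T : ℕ)
    (c : Fin n → ℕ) :
    BddAbove {R | ∃ x0 x, UBFeasible n v α T c x0 x ∧ (T : ℝ) * ∑ i, r i * x i = R} := by
  refine ⟨(T : ℝ) * ∑ i, r i * ((c i : ℝ) / (T : ℝ)), ?_⟩
  rintro R ⟨x0, x, hx, rfl⟩
  exact mul_le_mul_of_nonneg_left
    (sum_le_sum fun i _ => mul_le_mul_of_nonneg_left (hx.2 i) (hr i).le) (Nat.cast_nonneg T)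

/-- A constant assortment vector is UB-feasible as soon as its common value `s` is at most every
`c i / T` and at most `a / (1 + n * b)`, where `a ≤ v i ≤ b` for all `i`. -/
lemma UBFeasible_const (n : ℕ) (v : Fin n → ℝ) (α : ℝ) (hα1 : α ≤ 1) (T : ℕ) (c : Fin n → ℕ)
    (a b s : ℝ) (ha : 0 ≤ a) (hab : a ≤ b) (hav : ∀ i, a ≤ v i) (hs0 : 0 ≤ s)
    (hsc : ∀ i, s ≤ (c i : ℝ) / (T : ℝ)) (hs : s ≤ a / (1 + (n : ℝ) * b)) :
    UBFeasible n v α T c (1 - n * s) fun _ => s := by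
  have hn0 : (0 : ℝ) ≤ n := Nat.cast_nonneg n
  have hD : 0 < 1 + (n : ℝ) * b := by
    have := mul_nonneg hn0 (ha.trans hab)
    linarith
  have hx0 : 1 / (1 + (n : ℝ) * b) ≤ 1 - n * s := by
    have h1 : (n : ℝ) * s ≤ n * (b / (1 + (n : ℝ) * b)) := by
      gcongr
      exact hs.trans (by gcongr)
    have h2 : 1 / (1 + (n : ℝ) * b) + n * (b / (1 + (n : ℝ) * b)) = 1 := by
      field_simp
    linarith
  refine ⟨⟨by simp, fun i => ⟨hs0, ?_⟩, fun i => Or.inr fun _ => ?_⟩, hsc⟩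
  · calc s ≤ a * (1 / (1 + (n : ℝ) * b)) := by rwa [mul_one_div]
      _ ≤ v i * (1 - n * s) :=
        mul_le_mul (hav i) hx0 (one_div_pos.2 hD).le (ha.trans (hav i))
  · exact mul_le_of_le_one_left hs0 hα1

/-- every optimal solution of the Upper-Bound problem satisfies
`max_i x_i ≥ min{ c_min/T , v_min/(1 + n·v_max) }`. -/
theorem stmt_19 (n : ℕ) (hn : 1 ≤ n) (r v : Fin n → ℝ)
    (hr : ∀ i, 0 < r i) (hv : ∀ i, 0 < v i)
    (α : ℝ) (hα0 : 0 < α) (hα1 : α ≤ 1)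
    (T : ℕ) (hT : 0 < T) (c : Fin n → ℕ) (hc : ∀ i, 0 < c i)
    (x0 : ℝ) (x : Fin n → ℝ)
    (hfeas : UBFeasible n v α T c x0 x)
    (hopt : (T : ℝ) * ∑ i, r i * x i = UBopt n r v α T c) :
    min ((Finset.univ.inf' ⟨⟨0, hn⟩, Finset.mem_univ _⟩ fun i => (c i : ℝ)) / (T : ℝ))
        ((Finset.univ.inf' ⟨⟨0, hn⟩, Finset.mem_univ _⟩ v) /
          (1 + (n : ℝ) * Finset.univ.sup' ⟨⟨0, hn⟩, Finset.mem_univ _⟩ v)) ≤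
      Finset.univ.sup' ⟨⟨0, hn⟩, Finset.mem_univ _⟩ x := by
  by_contra! hlt
  set i₀ : Fin n := ⟨0, hn⟩
  have hne : (Finset.univ : Finset (Fin n)).Nonempty := ⟨i₀, Finset.mem_univ _⟩
  set s := min ((Finset.univ.inf' hne fun i => (c i : ℝ)) / (T : ℝ))
    ((Finset.univ.inf' hne v) / (1 + (n : ℝ) * Finset.univ.sup' hne v))
  have hxs : ∀ i, x i < s := fun i => (Finset.le_sup' x (Finset.mem_univ i)).trans_lt hlt
  have hs0 : 0 ≤ s := (hfeas.1.2.1 i₀).1.trans (hxs i₀).le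
  have hTpos : (0 : ℝ) < T := Nat.cast_pos.2 hT
  have hfeas' := UBFeasible_const n v α hα1 T c (Finset.univ.inf' hne v) (Finset.univ.sup' hne v) s
    (Finset.le_inf' _ _ fun i _ => (hv i).le)
    ((Finset.inf'_le v (Finset.mem_univ i₀)).trans (Finset.le_sup' v (Finset.mem_univ i₀)))
    (fun i => Finset.inf'_le v (Finset.mem_univ i)) hs0
    (fun i => (min_le_left _ _).trans (div_le_div_of_nonneg_right
      (Finset.inf'_le (fun i => (c i : ℝ)) (Finset.mem_univ i)) hTpos.le))
    (min_le_right _ _)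
  have hle : (T : ℝ) * ∑ i, r i * s ≤ UBopt n r v α T c :=
    le_csSup (bddAbove_UB n r v hr α T c) ⟨_, _, hfeas', rfl⟩
  rw [← hopt] at hle
  exact hle.not_gt (mul_lt_mul_of_pos_left
    (Finset.sum_lt_sum_of_nonempty hne fun i _ => mul_lt_mul_of_pos_left (hxs i) (hr i)) hTpos)
end
end
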